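/- Let p > 1 and C > 0, and let (M_j)_{j≥0} be a sequence of positive real numbers satisfying M_j ≥ C·p^{−j}·M_{j−1}^p for all j ≥ 1. Then for every j ≥ 0, log M_j ≥ p^j·( log M₀ − (p·log p)/(p−1)² + (log C)/(p−1) ) + ((j·(p−1) + p)/(p−1)²)·log p − (log C)/(p−1). In particular, for every j ≥ j₁, where j₁ is the smallest nonnegative integer with j₁ ≥ (log C)/(log p) − p/(p−1), one has log M_j ≥ p^j·( log M₀ − (p·log p)/(p−1)² + (log C)/(p−1) ). -/

import Mathlib

/-- Taking logarithms in `C p^{-t} x^p ≤ y`. -/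
theorem log_le_of_mul_rpow_le {p C t x y : ℝ} (hp : 0 < p) (hC : 0 < C) (hx : 0 < x)
    (h : C * p ^ (-t) * x ^ p ≤ y) :
    Real.log C - t * Real.log p + p * Real.log x ≤ Real.log y := by
  have hpt : 0 < p ^ (-t) := Real.rpow_pos_of_pos hp _
  have hxp : 0 < x ^ p := Real.rpow_pos_of_pos hx _
  have hlog := Real.log_le_log (by positivity) h
  rw [Real.log_mul (by positivity) hxp.ne', Real.log_mul hC.ne' hpt.ne', Real.log_rpow hp,
    Real.log_rpow hx] at hlog
  linarith


/-- Lower bound for the multiplicative constants of the iteration: if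
`M_j ≥ C p^{-j} M_{j-1}^p` for all `j ≥ 1`, then
`log M_j ≥ p^j (log M₀ - p log p/(p-1)² + log C/(p-1))
  + ((j(p-1)+p)/(p-1)²) log p - log C/(p-1)`,
and in particular, for every `j ≥ (log C)/(log p) - p/(p-1)` one has
`log M_j ≥ p^j (log M₀ - p log p/(p-1)² + log C/(p-1))`. -/
theorem iteration_constant_lower_bound
    (p C : ℝ) (hp : 1 < p) (hC : 0 < C)
    (M : ℕ → ℝ) (hMpos : ∀ j : ℕ, 0 < M j)
    (hrec : ∀ j : ℕ, 1 ≤ j → C * p ^ (-(j : ℝ)) * M (j - 1) ^ p ≤ M j) :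
    (∀ j : ℕ,
      p ^ j * (Real.log (M 0) - p * Real.log p / (p - 1) ^ 2 + Real.log C / (p - 1))
        + ((j : ℝ) * (p - 1) + p) / (p - 1) ^ 2 * Real.log p - Real.log C / (p - 1)
        ≤ Real.log (M j)) ∧
    (∀ j : ℕ, Real.log C / Real.log p - p / (p - 1) ≤ (j : ℝ) →
      p ^ j * (Real.log (M 0) - p * Real.log p / (p - 1) ^ 2 + Real.log C / (p - 1))
        ≤ Real.log (M j)) := by
  have hd : 0 < p - 1 := sub_pos.mpr hp
  have hL : 0 < Real.log p := Real.log_pos hp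
  have bound : ∀ j : ℕ,
      p ^ j * (Real.log (M 0) - p * Real.log p / (p - 1) ^ 2 + Real.log C / (p - 1))
        + ((j : ℝ) * (p - 1) + p) / (p - 1) ^ 2 * Real.log p - Real.log C / (p - 1)
        ≤ Real.log (M j) := by
    intro j
    induction j with
    | zero =>
      apply le_of_eq
      push_cast
      ring
    | succ j ih =>
      have hstep := log_le_of_mul_rpow_le (by linarith) hC (hMpos j) (hrec (j + 1) (by simp))
      refine le_trans (le_of_eq ?_)
        ((add_le_add_right (mul_le_mul_of_nonneg_left ih (by linarith : 0 ≤ p)) _).trans hstep)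
      push_cast
      field_simp
      ring
  refine ⟨bound, fun j hj => le_trans ?_ (bound j)⟩
  have hC_le : Real.log C ≤ (j + p / (p - 1)) * Real.log p :=
    (div_le_iff₀ hL).mp (by linarith)
  have hrem : ((j : ℝ) * (p - 1) + p) / (p - 1) ^ 2 * Real.log p
      = (j + p / (p - 1)) * Real.log p / (p - 1) := by
    field_simp
  have := div_le_div_of_nonneg_right hC_le hd.le
  linarith
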